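/- Let π be a probability measure on ℝ, let a ≠ 0 and σ > 0, and let γ be the standard Gaussian measure N(0,1) on ℝ. Then the pushforward of the product measure π ⊗ γ under the map (μ, z) ↦ aμ + σz has a density with respect to Lebesgue measure given by p(x) = (2πσ²)^{−1/2} ∫ exp(−(x−aμ)²/(2σ²)) dπ(μ); moreover p is everywhere positive and differentiable, and for every x ∈ ℝ, (log p)'(x) = (1/σ²)·( a·(∫ μ exp(−(x−aμ)²/(2σ²)) dπ(μ)) / (∫ exp(−(x−aμ)²/(2σ²)) dπ(μ)) − x ). In particular, for a = e^{−t/2} and σ² = 1 − e^{−t} this is Tweedie's formula for the marginal density p_t of the Ornstein–Uhlenbeck forward process dX_t = −(1/2)X_t dt + dB_t started from X_0 ~ π. -/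

import Mathlib

open MeasureTheory ProbabilityTheory

lemma aux_bound (s u : ℝ) (hs : 0 < s) :
    |u| * Real.exp (-u ^ 2 / (2 * s)) ≤ 1 + 2 * s := by
  have h1 : 1 + u ^ 2 / (2 * s) ≤ Real.exp (u ^ 2 / (2 * s)) := by
    linarith [Real.add_one_le_exp (u ^ 2 / (2 * s))]
  have h2 : |u| ≤ (1 + 2 * s) * (1 + u ^ 2 / (2 * s)) := by
    have : (1 + 2 * s) * (1 + u ^ 2 / (2 * s)) = 1 + 2 * s + u ^ 2 / (2 * s) + u ^ 2 := by
      field_simp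
      ring
    have h3 : 0 ≤ u ^ 2 / (2 * s) := by positivity
    rw [this]
    nlinarith [sq_abs u, sq_nonneg (|u| - 1), abs_nonneg u]
  rw [neg_div, Real.exp_neg, ← div_eq_mul_inv, div_le_iff₀ (Real.exp_pos _)]
  exact h2.trans (mul_le_mul_of_nonneg_left h1 (by positivity))

lemma aux_int (π : Measure ℝ) [IsProbabilityMeasure π] (a s x : ℝ) (hs : 0 < s) :
    Integrable (fun μ => Real.exp (-(x - a * μ) ^ 2 / (2 * s))) π := by
  refine Integrable.of_bound (by fun_prop) 1 (Filter.Eventually.of_forall fun μ => ?_)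
  rw [Real.norm_eq_abs, Real.abs_exp, Real.exp_le_one_iff, neg_div]
  have : 0 ≤ (x - a * μ) ^ 2 / (2 * s) := by positivity
  linarith

lemma aux_int2 (π : Measure ℝ) [IsProbabilityMeasure π] (a s x : ℝ) (hs : 0 < s) :
    Integrable (fun μ => (x - a * μ) * Real.exp (-(x - a * μ) ^ 2 / (2 * s))) π := by
  refine Integrable.of_bound (by fun_prop) (1 + 2 * s) (Filter.Eventually.of_forall fun μ => ?_)
  rw [Real.norm_eq_abs, abs_mul, Real.abs_exp]
  exact aux_bound s _ hs

lemma aux_deriv (π : Measure ℝ) [IsProbabilityMeasure π] (a s x : ℝ) (ha : a ≠ 0) (hs : 0 < s) :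
    HasDerivAt (fun x => ∫ μ, Real.exp (-(x - a * μ) ^ 2 / (2 * s)) ∂π)
      ((1 / s) * (a * (∫ μ, μ * Real.exp (-(x - a * μ) ^ 2 / (2 * s)) ∂π)
        - x * ∫ μ, Real.exp (-(x - a * μ) ^ 2 / (2 * s)) ∂π)) x := by
  have key := (hasDerivAt_integral_of_dominated_loc_of_deriv_le (μ := π) (x₀ := x)
    (F := fun x μ => Real.exp (-(x - a * μ) ^ 2 / (2 * s)))
    (F' := fun x μ => -(1 / s) * ((x - a * μ) * Real.exp (-(x - a * μ) ^ 2 / (2 * s))))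
    (bound := fun _ => (1 / s) * (1 + 2 * s)) (s := Set.univ) Filter.univ_mem
    (Filter.Eventually.of_forall fun y => (aux_int π a s y hs).aestronglyMeasurable)
    (aux_int π a s x hs) ((aux_int2 π a s x hs).const_mul _).aestronglyMeasurable
    (Filter.Eventually.of_forall fun μ y _ => by
      rw [Real.norm_eq_abs, abs_mul, abs_mul, Real.abs_exp, abs_neg,
        abs_of_pos (by positivity : 0 < 1 / s)]
      exact mul_le_mul_of_nonneg_left (aux_bound s _ hs) (by positivity))
    (integrable_const _)
    (Filter.Eventually.of_forall fun μ y _ => by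
      have h := (((((hasDerivAt_id y).sub_const (a * μ)).pow 2).neg).div_const (2 * s)).exp
      refine h.congr_deriv ?_
      simp only [id, Pi.pow_apply, Pi.sub_apply, Pi.neg_apply]
      field_simp
      norm_num
      ring)).2
  refine key.congr_deriv ?_
  rw [integral_const_mul]
  have h1 : (fun μ => a * (μ * Real.exp (-(x - a * μ) ^ 2 / (2 * s)))) =
      fun μ => x * Real.exp (-(x - a * μ) ^ 2 / (2 * s))
        - (x - a * μ) * Real.exp (-(x - a * μ) ^ 2 / (2 * s)) := by
    ext μ; ring
  rw [← integral_const_mul a, h1, integral_sub ((aux_int π a s x hs).const_mul x)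
    (aux_int2 π a s x hs), integral_const_mul]
  ring

/-- The law of `a·X₀ + σ·Z` (with `X₀ ~ π`, `Z ~ N(0,1)` independent) has Lebesgue density
`p x = (2πσ²)^{-1/2} ∫ exp (-(x - aμ)²/(2σ²)) dπ(μ)`; `p` is everywhere positive and
differentiable, and its score satisfies Tweedie's formula
`(log p)'(x) = (1/σ²) (a · (∫ μ e^{-(x-aμ)²/(2σ²)} dπ)/(∫ e^{-(x-aμ)²/(2σ²)} dπ) - x)`. -/
theorem stmt1 (π : Measure ℝ) [IsProbabilityMeasure π] (a σ : ℝ) (ha : a ≠ 0) (hσ : 0 < σ)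
    (p : ℝ → ℝ)
    (hp : ∀ x, p x = (2 * Real.pi * σ ^ 2) ^ (-(1 : ℝ) / 2) *
      ∫ μ, Real.exp (-(x - a * μ) ^ 2 / (2 * σ ^ 2)) ∂π) :
    Measure.map (fun q : ℝ × ℝ => a * q.1 + σ * q.2) (π.prod (gaussianReal 0 1))
      = volume.withDensity (fun x => ENNReal.ofReal (p x)) ∧
    (∀ x, 0 < p x) ∧
    (∀ x, DifferentiableAt ℝ p x) ∧
    (∀ x, deriv (fun y => Real.log (p y)) x
      = (1 / σ ^ 2) * (a * (∫ μ, μ * Real.exp (-(x - a * μ) ^ 2 / (2 * σ ^ 2)) ∂π)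
          / (∫ μ, Real.exp (-(x - a * μ) ^ 2 / (2 * σ ^ 2)) ∂π) - x)) := by
  have hs : 0 < σ ^ 2 := by positivity
  have hIpos : ∀ x, 0 < ∫ μ, Real.exp (-(x - a * μ) ^ 2 / (2 * σ ^ 2)) ∂π := fun x =>
    integral_exp_pos (aux_int π a _ x hs)
  have hc : 0 < (2 * Real.pi * σ ^ 2) ^ (-(1 : ℝ) / 2) := by positivity
  have hppos : ∀ x, 0 < p x := fun x => by rw [hp]; exact mul_pos hc (hIpos x)
  have hd : ∀ x, HasDerivAt p _ x := fun x => by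
    rw [funext hp]
    exact (aux_deriv π a _ x ha hs).const_mul _
  refine ⟨?_, hppos, fun x => (hd x).differentiableAt, fun x => ?_⟩
  · let v : NNReal := ⟨σ ^ 2, hs.le⟩
    have hv : v ≠ 0 := fun h => hs.ne' (congrArg NNReal.toReal h)
    have hpdf : ∀ x μ, gaussianPDFReal (a * μ) v x =
        (2 * Real.pi * σ ^ 2) ^ (-(1 : ℝ) / 2) * Real.exp (-(x - a * μ) ^ 2 / (2 * σ ^ 2)) := by
      intro x μ
      have : (-(1 : ℝ) / 2) = -(1 / 2) := by ring
      rw [this, Real.rpow_neg (by positivity), ← Real.sqrt_eq_rpow]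
      rfl
    have hm : Measurable (fun q : ℝ × ℝ => a * q.1 + σ * q.2) := by fun_prop
    ext t ht
    rw [Measure.map_apply hm ht, Measure.prod_apply (hm ht), withDensity_apply _ ht]
    have h1 : ∀ μ, gaussianReal 0 1 (Prod.mk μ ⁻¹' ((fun q : ℝ × ℝ => a * q.1 + σ * q.2) ⁻¹' t))
        = ∫⁻ x in t, gaussianPDF (a * μ) v x := by
      intro μ
      rw [← gaussianReal_apply _ hv]
      have h2 : gaussianReal (a * μ) v =
          ((gaussianReal 0 1).map (fun z => σ * z)).map (fun z => a * μ + z) := by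
        rw [gaussianReal_map_const_mul, gaussianReal_map_const_add]
        congr 1
        · ring
        · ext; simp; rfl
      rw [h2, Measure.map_map (by fun_prop) (by fun_prop),
        Measure.map_apply (by fun_prop) ht]
      rfl
    simp_rw [h1]
    have hmeas : Measurable (Function.uncurry fun μ x => gaussianPDF (a * μ) v x) := by
      have : Measurable (fun q : ℝ × ℝ => (a * q.1, v, q.2)) := by fun_prop
      exact measurable_uncurry_gaussianPDF.comp this
    rw [lintegral_lintegral_swap hmeas.aemeasurable]
    refine lintegral_congr fun x => ?_
    rw [hp, ← integral_const_mul, ofReal_integral_eq_lintegral_ofReal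
      ((aux_int π a _ x hs).const_mul _)
      (Filter.Eventually.of_forall fun μ => by positivity)]
    refine lintegral_congr fun μ => ?_
    rw [gaussianPDF, hpdf]
  · rw [((hd x).log (hppos x).ne').deriv, hp]
    have h1 := (hIpos x).ne'
    have h2 := hc.ne'
    generalize (∫ μ, Real.exp (-(x - a * μ) ^ 2 / (2 * σ ^ 2)) ∂π) = A at *
    generalize (∫ μ, μ * Real.exp (-(x - a * μ) ^ 2 / (2 * σ ^ 2)) ∂π) = B at *
    generalize (2 * Real.pi * σ ^ 2) ^ (-(1 : ℝ) / 2) = C at *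
    field_simp
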